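/- (Main theorem, antipodal case) Let X be an antipodal s-distance set on the unit sphere S^{d-1} in ℝ^d, and let Y ⊆ X be a subset with X = Y ∪ (−Y) and |X| = 2|Y|. Let F_Y(t) := ∏_{α ∈ A(Y)} (t − α), a polynomial of degree s−1, and write its Gegenbauer expansion F_Y(t) = Σ_{i=0}^{s−1} f_i · G_i^{(d)}(t) with real coefficients f_i. Then |X| ≤ 2 · Σ_{i : f_i > 0} h_i, where the sum runs over those indices 0 ≤ i ≤ s−1 with f_i > 0, and h_i = C(d+i−1, i) − C(d+i−3, i−2). -/

import Mathlib

open scoped RealInnerProductSpace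

/-- The set of inner products between distinct points of a finite subset of `ℝ^d`. -/
noncomputable def innerSet {d : ℕ} (X : Finset (EuclideanSpace ℝ (Fin d))) : Finset ℝ :=
  haveI := Classical.decEq (EuclideanSpace ℝ (Fin d))
  haveI := Classical.decEq ℝ
  X.offDiag.image (fun p => ⟪p.1, p.2⟫)

/-- The Gegenbauer polynomials `G_l^{(d)}`, defined by `G_0 = 1`, `G_1 = d·t` and the
recurrence `t·G_l = λ_{l+1}·G_{l+1} + (1 - λ_{l-1})·G_{l-1}` with `λ_l = l/(d+2l-2)`. -/
noncomputable def Geg (d : ℕ) : ℕ → Polynomial ℝ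
  | 0 => 1
  | 1 => Polynomial.C (d : ℝ) * Polynomial.X
  | (n+2) => Polynomial.C (((d : ℝ) + 2*(n+2) - 2)/((n : ℝ)+2)) *
      (Polynomial.X * Geg d (n+1) - Polynomial.C (1 - (n : ℝ)/((d : ℝ)+2*n-2)) * Geg d n)

/-- `h_l = C(d+l-1, l) - C(d+l-3, l-2)` (with the convention `C(n,k) = 0` for `k < 0`),
the dimension of the space of harmonic homogeneous polynomials of degree `l` in `d` variables. -/
def hDim (d l : ℕ) : ℕ :=
  Nat.choose (d + l - 1) l - (if 2 ≤ l then Nat.choose (d + l - 3) (l - 2) else 0)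

section FischerForm

open MvPolynomial Finset

/-- The Fischer (apolar) inner product of polynomials. -/
noncomputable def fischer {σ : Type*} [Fintype σ] (p q : MvPolynomial σ ℝ) : ℝ :=
  ∑ m ∈ p.support, (∏ i, ((m i).factorial : ℝ)) * p.coeff m * q.coeff m

variable {σ : Type*} [Fintype σ]

theorem fischer_eq_sum_of_support_subset (p q : MvPolynomial σ ℝ) {S : Finset (σ →₀ ℕ)}
    (hS : p.support ⊆ S) :
    fischer p q = ∑ m ∈ S, (∏ i, ((m i).factorial : ℝ)) * p.coeff m * q.coeff m := by
  refine Finset.sum_subset hS fun m _ hm => ?_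
  simp [MvPolynomial.notMem_support_iff.mp hm]

theorem fischer_add_left (p p' q : MvPolynomial σ ℝ) :
    fischer (p + p') q = fischer p q + fischer p' q := by
  classical
  rw [fischer_eq_sum_of_support_subset (p + p') q MvPolynomial.support_add,
    fischer_eq_sum_of_support_subset p q Finset.subset_union_left,
    fischer_eq_sum_of_support_subset p' q Finset.subset_union_right, ← Finset.sum_add_distrib]
  refine Finset.sum_congr rfl fun m _ => ?_
  rw [MvPolynomial.coeff_add]; ring

theorem fischer_smul_left (a : ℝ) (p q : MvPolynomial σ ℝ) :
    fischer (a • p) q = a * fischer p q := by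
  rw [fischer_eq_sum_of_support_subset (a • p) q MvPolynomial.support_smul, fischer,
    Finset.mul_sum]
  refine Finset.sum_congr rfl fun m _ => ?_
  rw [MvPolynomial.coeff_smul, smul_eq_mul]; ring

theorem fischer_comm (p q : MvPolynomial σ ℝ) : fischer p q = fischer q p := by
  classical
  rw [fischer_eq_sum_of_support_subset p q (S := p.support ∪ q.support) Finset.subset_union_left,
    fischer_eq_sum_of_support_subset q p (S := p.support ∪ q.support) Finset.subset_union_right]
  exact Finset.sum_congr rfl fun m _ => by ring

/-- The Fischer form as a bilinear map. -/
noncomputable def fischerForm (σ : Type*) [Fintype σ] :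
    MvPolynomial σ ℝ →ₗ[ℝ] MvPolynomial σ ℝ →ₗ[ℝ] ℝ :=
  LinearMap.mk₂ ℝ fischer fischer_add_left fischer_smul_left
    (fun p q q' => by
      rw [fischer_comm, fischer_add_left, fischer_comm q, fischer_comm q'])
    (fun a p q => by rw [fischer_comm, fischer_smul_left, fischer_comm q, smul_eq_mul])

theorem fischerForm_self_nonneg (p : MvPolynomial σ ℝ) : 0 ≤ fischerForm σ p p :=
  Finset.sum_nonneg fun m _ => by
    rw [mul_assoc]
    exact mul_nonneg (Finset.prod_nonneg fun i _ => Nat.cast_nonneg _) (mul_self_nonneg _)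

theorem eq_zero_of_fischerForm_self_eq_zero {p : MvPolynomial σ ℝ}
    (h : fischerForm σ p p = 0) : p = 0 := by
  by_contra hp
  obtain ⟨m, hm⟩ := MvPolynomial.support_nonempty.mpr hp
  have hpos : 0 < fischerForm σ p p := by
    refine Finset.sum_pos (fun m hm => ?_) ⟨m, hm⟩
    rw [mul_assoc]
    exact mul_pos (Finset.prod_pos fun i _ => by positivity)
      (mul_self_pos.mpr (MvPolynomial.mem_support_iff.mp hm))
  exact hpos.ne' h

theorem fischerForm_monomial (m : σ →₀ ℕ) (a : ℝ) (q : MvPolynomial σ ℝ) :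
    fischerForm σ (monomial m a) q = (∏ i, ((m i).factorial : ℝ)) * a * q.coeff m := by
  classical
  change fischer _ _ = _
  rw [fischer_eq_sum_of_support_subset _ q MvPolynomial.support_monomial_subset,
    Finset.sum_singleton, MvPolynomial.coeff_monomial, if_pos rfl]

theorem fischerForm_X_mul (i : σ) (p q : MvPolynomial σ ℝ) :
    fischerForm σ (X i * p) q = fischerForm σ p (pderiv i q) := by
  classical
  induction p using MvPolynomial.induction_on' with
  | monomial m a =>
    have hX : X i * monomial m a = monomial (m + Finsupp.single i 1) a := by
      rw [mul_comm, X, monomial_mul, mul_one]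
    rw [hX, fischerForm_monomial, fischerForm_monomial, coeff_pderiv]
    have hf : ∏ j, (((m + Finsupp.single i 1 : σ →₀ ℕ) j).factorial : ℝ)
        = (m i + 1) * ∏ j, ((m j).factorial : ℝ) := by
      rw [← Finset.mul_prod_erase _ _ (Finset.mem_univ i),
        ← Finset.mul_prod_erase _ (fun j => ((m j).factorial : ℝ)) (Finset.mem_univ i),
        ← mul_assoc]
      congr 1
      · simp [Nat.factorial_succ]
      · refine Finset.prod_congr rfl fun j hj => ?_
        simp [Finsupp.single_eq_of_ne (Finset.ne_of_mem_erase hj)]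
    rw [hf]
    ring
  | add p p' hp hp' => rw [mul_add, map_add, map_add, LinearMap.add_apply, LinearMap.add_apply, hp,
      hp']

/-- The Laplacian on polynomials. -/
noncomputable def laplacian (σ : Type*) [Fintype σ] :
    MvPolynomial σ ℝ →ₗ[ℝ] MvPolynomial σ ℝ :=
  ∑ i, (pderiv i).toLinearMap ∘ₗ (pderiv i).toLinearMap

/-- The directional derivative along `y`. -/
noncomputable def dirDeriv (y : σ → ℝ) : Derivation ℝ (MvPolynomial σ ℝ) (MvPolynomial σ ℝ) :=
  ∑ i, y i • pderiv i

/-- The linear form `x ↦ ⟨x, y⟩`. -/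
noncomputable def linForm (y : σ → ℝ) : MvPolynomial σ ℝ := ∑ i, y i • X i

/-- The polynomial `x ↦ |x|²`. -/
noncomputable def normSqPoly (σ : Type*) [Fintype σ] : MvPolynomial σ ℝ := ∑ i, X i * X i

theorem laplacian_apply (p : MvPolynomial σ ℝ) :
    laplacian σ p = ∑ i, pderiv i (pderiv i p) := by
  simp [laplacian]

theorem dirDeriv_apply (y : σ → ℝ) (p : MvPolynomial σ ℝ) :
    dirDeriv y p = ∑ i, y i • pderiv i p := by
  rw [dirDeriv, ← Derivation.coeFnAddMonoidHom_apply, map_sum, Finset.sum_apply]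
  rfl

theorem fischerForm_normSqPoly_mul (p q : MvPolynomial σ ℝ) :
    fischerForm σ (normSqPoly σ * p) q = fischerForm σ p (laplacian σ q) := by
  simp [normSqPoly, laplacian_apply, Finset.sum_mul, mul_assoc, fischerForm_X_mul]

theorem fischerForm_linForm_mul (y : σ → ℝ) (p q : MvPolynomial σ ℝ) :
    fischerForm σ (linForm y * p) q = fischerForm σ p (dirDeriv y q) := by
  simp [linForm, dirDeriv_apply, Finset.sum_mul, fischerForm_X_mul]

theorem pderiv_linForm (y : σ → ℝ) (i : σ) : pderiv i (linForm y) = C (y i) := by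
  classical
  simp [linForm, pderiv_X, Pi.single_apply, MvPolynomial.smul_eq_C_mul]

theorem pderiv_normSqPoly (i : σ) : pderiv i (normSqPoly σ) = 2 * X i := by
  classical
  simp [normSqPoly, pderiv_X, Pi.single_apply, Finset.sum_add_distrib, two_mul]

theorem dirDeriv_linForm (y : σ → ℝ) : dirDeriv y (linForm y) = C (∑ i, y i ^ 2) := by
  simp [dirDeriv_apply, pderiv_linForm, MvPolynomial.smul_eq_C_mul, pow_two]

theorem dirDeriv_normSqPoly (y : σ → ℝ) : dirDeriv y (normSqPoly σ) = 2 * linForm y := by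
  simp [dirDeriv_apply, pderiv_normSqPoly, linForm, Finset.mul_sum]

theorem laplacian_linForm_mul (y : σ → ℝ) (p : MvPolynomial σ ℝ) :
    laplacian σ (linForm y * p) = linForm y * laplacian σ p + 2 * dirDeriv y p := by
  simp only [laplacian_apply, dirDeriv_apply, Finset.mul_sum, ← Finset.sum_add_distrib]
  refine Finset.sum_congr rfl fun i _ => ?_
  simp only [pderiv_mul, pderiv_linForm, map_add, pderiv_C, MvPolynomial.smul_eq_C_mul]
  ring

theorem laplacian_normSqPoly_mul {n : ℕ} {p : MvPolynomial σ ℝ} (hp : p.IsHomogeneous n) :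
    laplacian σ (normSqPoly σ * p)
      = normSqPoly σ * laplacian σ p + (2 * (Fintype.card σ : ℝ) + 4 * n) • p := by
  have euler := hp.sum_X_mul_pderiv
  have h : laplacian σ (normSqPoly σ * p) = normSqPoly σ * laplacian σ p
      + (∑ _i : σ, 2 * p) + 4 * ∑ i, X i * pderiv i p := by
    simp only [laplacian_apply, Finset.mul_sum, ← Finset.sum_add_distrib]
    refine Finset.sum_congr rfl fun i _ => ?_
    have h2 : pderiv i (2 : MvPolynomial σ ℝ) = 0 := by
      rw [← map_ofNat C 2, pderiv_C]
    simp only [pderiv_mul, pderiv_normSqPoly, map_add, pderiv_X_self, h2]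
    ring
  rw [h, euler]
  simp only [Finset.sum_const, Finset.card_univ, nsmul_eq_mul, MvPolynomial.smul_eq_C_mul, map_add,
    map_mul, map_natCast, map_ofNat]
  ring

theorem isHomogeneous_linForm (y : σ → ℝ) : (linForm y).IsHomogeneous 1 :=
  IsHomogeneous.sum _ _ _ fun i _ => by
    rw [MvPolynomial.smul_eq_C_mul]; exact isHomogeneous_C_mul_X _ _

theorem isHomogeneous_normSqPoly : (normSqPoly σ).IsHomogeneous 2 :=
  IsHomogeneous.sum _ _ _ fun i _ => (isHomogeneous_X ℝ i).mul (isHomogeneous_X ℝ i)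

theorem isHomogeneous_dirDeriv (y : σ → ℝ) {n : ℕ} {p : MvPolynomial σ ℝ}
    (hp : p.IsHomogeneous (n + 1)) : (dirDeriv y p).IsHomogeneous n := by
  rw [dirDeriv_apply]
  refine IsHomogeneous.sum _ _ _ fun i _ => ?_
  rw [MvPolynomial.smul_eq_C_mul]
  exact (hp.pderiv (i := i)).C_mul _

/-- Powers of linear forms are reproducing for the Fischer form: `⟨⟨·, y⟩ⁿ, p⟩ = n! p(y)`. -/
theorem fischerForm_linForm_pow (y : σ → ℝ) {n : ℕ} {p : MvPolynomial σ ℝ}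
    (hp : p.IsHomogeneous n) :
    fischerForm σ (linForm y ^ n) p = n.factorial * eval y p := by
  induction n generalizing p with
  | zero =>
    rw [← totalDegree_zero_iff_isHomogeneous, totalDegree_eq_zero_iff_eq_C] at hp
    rw [hp, pow_zero, ← C_1, C_apply, fischerForm_monomial]
    simp
  | succ n ih =>
    have euler := congrArg (eval y) hp.sum_X_mul_pderiv
    have hd : eval y (dirDeriv y p) = ((n : ℝ) + 1) * eval y p := by
      simpa [dirDeriv_apply, MvPolynomial.smul_eq_C_mul] using euler
    rw [pow_succ', fischerForm_linForm_mul, ih (isHomogeneous_dirDeriv y hp), hd,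
      Nat.factorial_succ]
    push_cast
    ring

/-- The space of harmonic homogeneous polynomials of degree `l`. -/
noncomputable def harmonicSubmodule (σ : Type*) [Fintype σ] (l : ℕ) :
    Submodule ℝ (MvPolynomial σ ℝ) :=
  homogeneousSubmodule σ ℝ l ⊓ LinearMap.ker (laplacian σ)

theorem finrank_homogeneousSubmodule (l : ℕ) :
    Module.finrank ℝ (homogeneousSubmodule σ ℝ l) = (Fintype.card σ).multichoose l := by
  classical
  have hspan : homogeneousSubmodule σ ℝ l = Submodule.span ℝ
      (Set.range fun m : (univ : Finset σ).finsuppAntidiag l => monomial (m : σ →₀ ℕ) (1 : ℝ)) := by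
    refine le_antisymm (fun p hp => ?_) (Submodule.span_le.mpr ?_)
    · rw [p.as_sum]
      refine Submodule.sum_mem _ fun m hm => ?_
      have hdeg := hp.degree_eq_sum_deg_support hm
      have hm' : m ∈ (univ : Finset σ).finsuppAntidiag l := by
        rw [mem_finsuppAntidiag]
        exact ⟨by rw [hdeg, ← Finsupp.degree_eq_sum]; rfl, Finset.subset_univ _⟩
      have : monomial m (p.coeff m) = p.coeff m • monomial m (1 : ℝ) := by
        rw [smul_monomial, smul_eq_mul, mul_one]
      rw [this]
      exact Submodule.smul_mem _ _ (Submodule.subset_span ⟨⟨m, hm'⟩, rfl⟩)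
    · rintro _ ⟨⟨m, hm⟩, rfl⟩
      refine isHomogeneous_monomial _ ?_
      rw [Finsupp.degree_eq_sum]
      exact (mem_finsuppAntidiag.mp hm).1
  have hli : LinearIndependent ℝ
      fun m : (univ : Finset σ).finsuppAntidiag l => monomial (m : σ →₀ ℕ) (1 : ℝ) := by
    have := (basisMonomials σ ℝ).linearIndependent.comp
      (fun m : (univ : Finset σ).finsuppAntidiag l => (m : σ →₀ ℕ)) Subtype.val_injective
    simpa [Function.comp_def] using this
  rw [hspan, finrank_span_eq_card hli, Fintype.card_coe, card_finsuppAntidiag_nat_eq_multichoose,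
    Finset.card_univ]

instance (l : ℕ) : FiniteDimensional ℝ (homogeneousSubmodule σ ℝ l) :=
  Module.Finite.iff_fg.mpr (homogeneousSubmodule_fg σ ℝ l)

instance (l : ℕ) : FiniteDimensional ℝ (harmonicSubmodule σ l) :=
  Submodule.finiteDimensional_of_le (S₂ := homogeneousSubmodule σ ℝ l) inf_le_left

theorem normSqPoly_ne_zero [Nonempty σ] : normSqPoly σ ≠ 0 := fun h => by
  have := congrArg (eval fun _ => (1 : ℝ)) h
  simp [normSqPoly] at this

theorem finrank_harmonicSubmodule_add_le [Nonempty σ] (l : ℕ) :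
    Module.finrank ℝ (harmonicSubmodule σ (l + 2)) + (Fintype.card σ).multichoose l
      ≤ (Fintype.card σ).multichoose (l + 2) := by
  set R := (homogeneousSubmodule σ ℝ l).map (LinearMap.mulLeft ℝ (normSqPoly σ))
  have hfR : Module.finrank ℝ R = (Fintype.card σ).multichoose l := by
    rw [← finrank_homogeneousSubmodule]
    exact (Submodule.equivMapOfInjective _
      (mul_right_injective₀ normSqPoly_ne_zero) _).finrank_eq.symm
  have hdisj : harmonicSubmodule σ (l + 2) ⊓ R = ⊥ := by
    rw [eq_bot_iff]
    rintro _ ⟨⟨_, hp⟩, q, _, rfl⟩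
    refine eq_zero_of_fischerForm_self_eq_zero ?_
    replace hp : laplacian σ (normSqPoly σ * q) = 0 := hp
    rw [LinearMap.mulLeft_apply]
    rw [fischerForm_normSqPoly_mul, hp, map_zero]
  have hle : harmonicSubmodule σ (l + 2) ⊔ R ≤ homogeneousSubmodule σ ℝ (l + 2) := by
    refine sup_le inf_le_left ?_
    rintro _ ⟨q, hq, rfl⟩
    rw [add_comm]
    exact isHomogeneous_normSqPoly.mul hq
  have h := Submodule.finrank_sup_add_finrank_inf_eq (harmonicSubmodule σ (l + 2)) R
  rw [hdisj, finrank_bot, add_zero, hfR] at h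
  rw [← h, ← finrank_homogeneousSubmodule]
  exact Submodule.finrank_mono hle

theorem finrank_harmonicSubmodule_le_hDim [Nonempty σ] (l : ℕ) :
    Module.finrank ℝ (harmonicSubmodule σ l) ≤ hDim (Fintype.card σ) l := by
  have hcard : 0 < Fintype.card σ := Fintype.card_pos
  rcases lt_or_ge l 2 with hl | hl
  · rw [hDim, if_neg (by omega), Nat.sub_zero, ← Nat.multichoose_eq,
      ← finrank_homogeneousSubmodule]
    exact Submodule.finrank_mono inf_le_left
  · obtain ⟨m, rfl⟩ := Nat.exists_eq_add_of_le' hl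
    have h := finrank_harmonicSubmodule_add_le (σ := σ) m
    rw [hDim, if_pos hl, ← Nat.multichoose_eq]
    have h2 : (Fintype.card σ + (m + 2) - 3).choose (m + 2 - 2)
        = (Fintype.card σ).multichoose m := by
      rw [Nat.multichoose_eq]
      congr 1
    omega

/-- The zonal polynomial with pole `y`: the homogenization of `t ↦ Geg d l t` at `t = ⟨x, y⟩`. -/
noncomputable def zonal (y : σ → ℝ) : ℕ → MvPolynomial σ ℝ
  | 0 => 1
  | 1 => C (Fintype.card σ : ℝ) * linForm y
  | (n+2) => C (((Fintype.card σ : ℝ) + 2*(n+2) - 2)/((n : ℝ)+2)) *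
      (linForm y * zonal y (n+1)
        - C (1 - (n : ℝ)/((Fintype.card σ : ℝ)+2*n-2)) * (normSqPoly σ * zonal y n))

theorem isHomogeneous_zonal (y : σ → ℝ) : ∀ n, (zonal y n).IsHomogeneous n
  | 0 => isHomogeneous_one _ _
  | 1 => (isHomogeneous_linForm y).C_mul _
  | (n+2) => by
    rw [zonal]
    refine IsHomogeneous.C_mul (IsHomogeneous.sub ?_ (IsHomogeneous.C_mul ?_ _)) _
    · have := (isHomogeneous_linForm y).mul (isHomogeneous_zonal y (n+1))
      rwa [show 1 + (n + 1) = n + 2 by ring] at this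
    · have := isHomogeneous_normSqPoly.mul (isHomogeneous_zonal y n)
      rwa [add_comm] at this

theorem eval_zonal (x y : σ → ℝ) (hx : ∑ i, x i ^ 2 = 1) :
    ∀ n, eval x (zonal y n) = (Geg (Fintype.card σ) n).eval (∑ i, x i * y i)
  | 0 => by simp [zonal, Geg]
  | 1 => by simp [zonal, Geg, linForm, mul_comm]
  | (n+2) => by
    have hL : eval x (linForm y) = ∑ i, x i * y i := by simp [linForm, mul_comm]
    have hN : eval x (normSqPoly σ) = 1 := by simp [normSqPoly, ← hx, pow_two]
    rw [zonal, Geg]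
    simp only [map_mul, map_sub, eval_C, Polynomial.eval_mul, Polynomial.eval_sub,
      Polynomial.eval_C, Polynomial.eval_X, hL, hN, eval_zonal x y hx n, eval_zonal x y hx (n+1),
      one_mul]

theorem exists_zonal_eq_linForm_pow_add [Nonempty σ] (n : ℕ) :
    ∃ a : ℝ, 0 < a ∧ ∀ y : σ → ℝ, ∃ q, zonal y n = C a * linForm y ^ n + normSqPoly σ * q := by
  have hcard : (1 : ℝ) ≤ Fintype.card σ := by exact_mod_cast Fintype.card_pos (α := σ)
  induction n using Nat.strong_induction_on with
  | _ n ih =>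
  match n, ih with
  | 0, _ => exact ⟨1, one_pos, fun y => ⟨0, by simp [zonal]⟩⟩
  | 1, _ => exact ⟨Fintype.card σ, by linarith, fun y => ⟨0, by simp [zonal]⟩⟩
  | (n+2), ih =>
    obtain ⟨a, ha, hq⟩ := ih (n + 1) (by omega)
    have hn : (0 : ℝ) ≤ n := n.cast_nonneg
    refine ⟨((Fintype.card σ : ℝ) + 2*(n+2) - 2)/((n : ℝ)+2) * a,
      mul_pos (div_pos (by linarith) (by linarith)) ha, fun y => ?_⟩
    obtain ⟨q, hq⟩ := hq y
    refine ⟨C (((Fintype.card σ : ℝ) + 2*(n+2) - 2)/((n : ℝ)+2)) * (linForm y * q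
      - C (1 - (n : ℝ)/((Fintype.card σ : ℝ)+2*n-2)) * zonal y n), ?_⟩
    rw [zonal, hq, map_mul]
    ring

theorem dirDeriv_zonal_succ (hcard : 2 ≤ Fintype.card σ) (y : σ → ℝ) (hy : ∑ i, y i ^ 2 = 1)
    (n : ℕ) :
    dirDeriv y (zonal y (n + 1)) =
      C (1 - (n : ℝ)/((Fintype.card σ : ℝ)+2*n-2)) * C ((Fintype.card σ : ℝ) + 2 * n)
        * zonal y n := by
  have hc2 : (2 : ℝ) ≤ Fintype.card σ := by exact_mod_cast hcard
  have hDC (a : ℝ) : dirDeriv y (C a) = 0 := (dirDeriv y).map_algebraMap a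
  have hL : dirDeriv y (linForm y) = 1 := by rw [dirDeriv_linForm, hy, C_1]
  have hstep (n : ℕ) : dirDeriv y (zonal y (n + 2)) =
      C (((Fintype.card σ : ℝ) + 2*(n+2) - 2)/((n : ℝ)+2)) *
      (zonal y (n+1) + linForm y * dirDeriv y (zonal y (n+1))
        - C (1 - (n : ℝ)/((Fintype.card σ : ℝ)+2*n-2)) *
          (2 * linForm y * zonal y n + normSqPoly σ * dirDeriv y (zonal y n))) := by
    rw [zonal]
    simp only [Derivation.leibniz, map_sub, hDC, hL, dirDeriv_normSqPoly, smul_eq_mul]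
    ring
  induction n using Nat.twoStepInduction with
  | zero => simp [zonal, hL, Derivation.leibniz]
  | one =>
    rw [hstep 0]
    simp only [zonal, Derivation.leibniz, hL, hDC, smul_eq_mul, Derivation.map_one_eq_zero]
    have h : C (((Fintype.card σ : ℝ) + 2*((0 : ℕ)+2) - 2)/(((0 : ℕ) : ℝ)+2)) *
        (2 * C (Fintype.card σ : ℝ) - 2 * C (1 - ((0 : ℕ) : ℝ)/((Fintype.card σ : ℝ)+2*(0 : ℕ)-2)))
        = C (1 - ((1 : ℕ) : ℝ)/((Fintype.card σ : ℝ)+2*(1 : ℕ)-2))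
          * C ((Fintype.card σ : ℝ) + 2 * (1 : ℕ)) * (C (Fintype.card σ : ℝ) : MvPolynomial σ ℝ) := by
      rw [← map_ofNat C 2]
      simp only [← map_mul, ← map_sub]
      congr 1
      push_cast
      rw [mul_one, add_sub_cancel_right]
      field_simp
      ring
    linear_combination linForm y * h
  | more n ih0 ih1 =>
    have hn : (0 : ℝ) ≤ n := n.cast_nonneg
    set d : ℝ := (Fintype.card σ : ℝ)
    rw [hstep (n + 1), ih0, ih1]
    have hz : zonal y (n + 2) = C ((d + 2*(n+2) - 2)/((n : ℝ)+2)) *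
      (linForm y * zonal y (n+1)
        - C (1 - (n : ℝ)/(d+2*n-2)) * (normSqPoly σ * zonal y n)) := by rw [zonal]
    have he : C ((d + 2 * n) * ((n : ℝ) + 2) / (d + 2*(n+2) - 2)) *
        C ((d + 2*(n+2) - 2)/((n : ℝ)+2)) = (C (d + 2 * n) : MvPolynomial σ ℝ) := by
      rw [← map_mul]
      congr 1
      have : d + 2*(n+2) - 2 ≠ 0 := by linarith
      field_simp
    have hs : (C (d + 2 * (n + 1 : ℕ)) : MvPolynomial σ ℝ) = C (d + 2 * n) + 2 := by
      rw [← map_ofNat C 2, ← map_add]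
      congr 1
      push_cast
      ring
    have hc : C ((d + 2*((n + 1 : ℕ)+2) - 2)/(((n + 1 : ℕ) : ℝ)+2)) *
        (1 + C (1 - ((n + 1 : ℕ) : ℝ)/(d+2*(n + 1 : ℕ)-2)) *
          C ((d + 2 * n) * ((n : ℝ) + 2) / (d + 2*(n+2) - 2))) =
        C (1 - ((n + 2 : ℕ) : ℝ)/(d+2*(n + 2 : ℕ)-2)) *
          (C (d + 2 * (n + 2 : ℕ)) : MvPolynomial σ ℝ) := by
      rw [← C_1]
      simp only [← map_mul, ← map_add]
      congr 1
      push_cast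
      have h1 : d + 2*(n+2) - 2 ≠ 0 := by linarith
      have h2 : d + 2*(n+1) - 2 ≠ 0 := by linarith
      have h3 : (n : ℝ) + 1 + 2 ≠ 0 := by linarith
      field_simp
      ring
    rw [hs]
    linear_combination zonal y (n + 2) * hc
      - C ((d + 2*((n + 1 : ℕ)+2) - 2)/(((n + 1 : ℕ) : ℝ)+2))
        * C (1 - ((n + 1 : ℕ) : ℝ)/(d+2*(n + 1 : ℕ)-2))
        * (linForm y * zonal y (n+1) - C (1 - (n : ℝ)/(d+2*n-2)) * (normSqPoly σ * zonal y n)) * he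
      - C ((d + 2*((n + 1 : ℕ)+2) - 2)/(((n + 1 : ℕ) : ℝ)+2))
        * C (1 - ((n + 1 : ℕ) : ℝ)/(d+2*(n + 1 : ℕ)-2))
        * C ((d + 2 * n) * ((n : ℝ) + 2) / (d + 2*(n+2) - 2)) * hz

theorem laplacian_zonal (hcard : 2 ≤ Fintype.card σ) (y : σ → ℝ) (hy : ∑ i, y i ^ 2 = 1) :
    ∀ n, laplacian σ (zonal y n) = 0
  | 0 => by simp [zonal, laplacian_apply]
  | 1 => by simp [zonal, laplacian_apply, pderiv_linForm]
  | (n+2) => by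
    rw [zonal, ← MvPolynomial.smul_eq_C_mul, ← MvPolynomial.smul_eq_C_mul, map_smul, map_sub,
      map_smul, laplacian_linForm_mul, laplacian_normSqPoly_mul (isHomogeneous_zonal y n),
      laplacian_zonal hcard y hy n, laplacian_zonal hcard y hy (n+1),
      dirDeriv_zonal_succ hcard y hy]
    simp only [MvPolynomial.smul_eq_C_mul]
    have : (C (2 * (Fintype.card σ : ℝ) + 4 * n) : MvPolynomial σ ℝ)
        = 2 * C ((Fintype.card σ : ℝ) + 2 * n) := by
      rw [← map_ofNat C 2, ← map_mul]
      congr 1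
      ring
    rw [this]
    ring

theorem zonal_mem_harmonicSubmodule (hcard : 2 ≤ Fintype.card σ) (y : σ → ℝ)
    (hy : ∑ i, y i ^ 2 = 1) (n : ℕ) : zonal y n ∈ harmonicSubmodule σ n :=
  ⟨isHomogeneous_zonal y n, laplacian_zonal hcard y hy n⟩

theorem exists_fischerForm_zonal (hcard : 2 ≤ Fintype.card σ) (n : ℕ) :
    ∃ a : ℝ, 0 < a ∧ ∀ x y : σ → ℝ, ∑ i, x i ^ 2 = 1 → ∑ i, y i ^ 2 = 1 →
      fischerForm σ (zonal x n) (zonal y n)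
        = a * (Geg (Fintype.card σ) n).eval (∑ i, x i * y i) := by
  have : Nonempty σ := Fintype.card_pos_iff.mp (by omega)
  obtain ⟨a, ha, h⟩ := exists_zonal_eq_linForm_pow_add (σ := σ) n
  refine ⟨a * n.factorial, by positivity, fun x y hx hy => ?_⟩
  obtain ⟨q, hq⟩ := h x
  rw [hq, map_add, LinearMap.add_apply, fischerForm_normSqPoly_mul, laplacian_zonal hcard y hy,
    map_zero, add_zero, ← MvPolynomial.smul_eq_C_mul, map_smul, LinearMap.smul_apply,
    fischerForm_linForm_pow x (isHomogeneous_zonal y n), eval_zonal x y hx, smul_eq_mul, mul_assoc]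
end FischerForm

/-- If `F` vanishes on the inner products of distinct points of `Y`, is positive at `1`, and has
Gegenbauer coefficients `f i`, then `|Y|` is at most the sum of `h_i` over `f i > 0`. -/
theorem card_le_sum_hDim_of_expansion {d : ℕ} (hd : 2 ≤ d)
    (Y : Finset (EuclideanSpace ℝ (Fin d))) (hY : ∀ y ∈ Y, ‖y‖ = 1) (F : Polynomial ℝ)
    (hF : ∀ x ∈ Y, ∀ y ∈ Y, x ≠ y → F.eval ⟪x, y⟫ = 0) (hF1 : 0 < F.eval 1)
    (s : ℕ) (f : ℕ → ℝ) (hexp : F = ∑ i ∈ Finset.range s, Polynomial.C (f i) * Geg d i) :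
    Y.card ≤ ∑ i ∈ (Finset.range s).filter (fun i => 0 < f i), hDim d i := by
  classical
  have hcard : 2 ≤ Fintype.card (Fin d) := by simpa using hd
  have : Nonempty (Fin d) := ⟨⟨0, by omega⟩⟩
  have hnorm (y : Y) : ∑ i, (y : EuclideanSpace ℝ (Fin d)) i ^ 2 = 1 := by
    rw [← EuclideanSpace.real_norm_sq_eq, hY y y.2, one_pow]
  by_contra! hlt
  set S := (Finset.range s).filter (fun i => 0 < f i)
  let T : (Y → ℝ) →ₗ[ℝ] ((i : S) → harmonicSubmodule (Fin d) i) :=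
    LinearMap.pi fun i => ∑ y : Y, (LinearMap.proj y : (Y → ℝ) →ₗ[ℝ] ℝ).smulRight
      ⟨zonal y.1 i, zonal_mem_harmonicSubmodule hcard y.1 (hnorm y) i⟩
  have hdim : Module.finrank ℝ ((i : S) → harmonicSubmodule (Fin d) i)
      < Module.finrank ℝ (Y → ℝ) := by
    rw [Module.finrank_pi_fintype, Module.finrank_fintype_fun_eq_card, Fintype.card_coe]
    refine lt_of_le_of_lt ?_ hlt
    rw [← Finset.sum_coe_sort S]
    refine Finset.sum_le_sum fun i _ => ?_
    simpa using finrank_harmonicSubmodule_le_hDim (σ := Fin d) i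
  obtain ⟨c, hcker, hc⟩ := (Submodule.ne_bot_iff _).mp
    (LinearMap.ker_ne_bot_of_finrank_lt (f := T) hdim)
  have hT (i : ℕ) (hi : i ∈ S) : ∑ y : Y, c y • zonal y.1 i = 0 := by
    have := congrArg Subtype.val (congrFun (LinearMap.mem_ker.mp hcker) ⟨i, hi⟩)
    simpa [T] using this
  have hterm (i : ℕ) (hi : i ∈ Finset.range s) :
      f i * ∑ x : Y, ∑ y : Y, c x * c y * (Geg d i).eval ⟪x.1, y.1⟫ ≤ 0 := by
    obtain ⟨a, ha, hzon⟩ := exists_fischerForm_zonal hcard i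
    have hform : fischerForm (Fin d) (∑ y : Y, c y • zonal y.1 i) (∑ y : Y, c y • zonal y.1 i)
        = a * ∑ x : Y, ∑ y : Y, c x * c y * (Geg d i).eval ⟪x.1, y.1⟫ := by
      simp only [map_sum, map_smul, LinearMap.sum_apply, LinearMap.smul_apply, smul_eq_mul,
        Finset.mul_sum]
      rw [Finset.sum_comm]
      refine Finset.sum_congr rfl fun x _ => Finset.sum_congr rfl fun y _ => ?_
      rw [hzon _ _ (hnorm _) (hnorm _), Fintype.card_fin, PiLp.inner_apply]
      simp only [RCLike.inner_apply, conj_trivial, mul_comm]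
      ring
    rcases le_or_gt (f i) 0 with hf | hf
    · refine mul_nonpos_of_nonpos_of_nonneg hf ?_
      have := fischerForm_self_nonneg (∑ y : Y, c y • zonal y.1 i)
      rw [hform] at this
      exact nonneg_of_mul_nonneg_right this ha
    · rw [hT i (Finset.mem_filter.mpr ⟨hi, hf⟩), map_zero] at hform
      rw [(mul_eq_zero.mp hform.symm).resolve_left ha.ne', mul_zero]
  have hle : ∑ x : Y, ∑ y : Y, c x * c y * F.eval ⟪x.1, y.1⟫ ≤ 0 := by
    refine le_trans (le_of_eq ?_) (Finset.sum_nonpos hterm)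
    simp only [hexp, Polynomial.eval_finsetSum, Polynomial.eval_mul, Polynomial.eval_C,
      Finset.mul_sum]
    conv_lhs =>
      enter [2, x]
      rw [Finset.sum_comm]
    rw [Finset.sum_comm]
    exact Finset.sum_congr rfl fun i _ => Finset.sum_congr rfl fun x _ =>
      Finset.sum_congr rfl fun y _ => by ring
  have heq : ∑ x : Y, ∑ y : Y, c x * c y * F.eval ⟪x.1, y.1⟫ = F.eval 1 * ∑ x : Y, c x ^ 2 := by
    rw [Finset.mul_sum]
    refine Finset.sum_congr rfl fun x _ => ?_
    rw [Finset.sum_eq_single x]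
    · rw [real_inner_self_eq_norm_sq, hY x x.2, one_pow]; ring
    · intro y _ hyx
      rw [hF x x.2 y y.2 fun h => hyx (Subtype.ext h.symm), mul_zero]
    · simp
  rw [heq] at hle
  have hsum : ∑ x : Y, c x ^ 2 = 0 :=
    le_antisymm (nonpos_of_mul_nonpos_right hle hF1) (Finset.sum_nonneg fun x _ => sq_nonneg _)
  refine hc (funext fun x => ?_)
  have := (Finset.sum_eq_zero_iff_of_nonneg fun x _ => sq_nonneg (c x)).mp hsum x (Finset.mem_univ x)
  simpa using this

open scoped Classical in
/-- **Main theorem, antipodal case.** Let `X` be an antipodal `s`-distance set on `S^{d-1}`,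
`Y ⊆ X` with `X = Y ∪ (-Y)` and `|X| = 2|Y|`, and let
`F_Y(t) = ∏_{α ∈ A(Y)} (t - α) = Σ_{i=0}^{s-1} f_i G_i^{(d)}(t)` (a polynomial of degree `s-1`).
Then `|X| ≤ 2·Σ_{i : f_i > 0} h_i`, summing over `0 ≤ i ≤ s-1` with `f_i > 0`. -/
theorem main_theorem_antipodal (d s : ℕ) (hd : 2 ≤ d) (hs : 1 ≤ s)
    (X Y : Finset (EuclideanSpace ℝ (Fin d)))
    (hsphere : ∀ x ∈ X, ‖x‖ = 1)
    (hdist : (innerSet X).card = s)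
    (hanti : ∀ x ∈ X, -x ∈ X)
    (hYX : Y ⊆ X)
    (hXY : X = Y ∪ Y.image (fun y => -y))
    (hhalf : X.card = 2 * Y.card)
    (hYdeg : (innerSet Y).card = s - 1)
    (f : ℕ → ℝ)
    (hexp : ∏ α ∈ innerSet Y, (Polynomial.X - Polynomial.C α) =
      ∑ i ∈ Finset.range s, Polynomial.C (f i) * Geg d i) :
    X.card ≤ 2 * ∑ i ∈ (Finset.range s).filter (fun i => 0 < f i), hDim d i := by
  have hY (y) (hy : y ∈ Y) : ‖y‖ = 1 := hsphere y (hYX hy)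
  have hmem (α : ℝ) : α ∈ innerSet Y ↔ ∃ x ∈ Y, ∃ y ∈ Y, x ≠ y ∧ ⟪x, y⟫ = α := by
    simp only [innerSet, Finset.mem_image, Finset.mem_offDiag, Prod.exists]
    constructor
    · rintro ⟨x, y, ⟨hx, hy, hne⟩, h⟩
      exact ⟨x, hx, y, hy, hne, h⟩
    · rintro ⟨x, hx, y, hy, hne, h⟩
      exact ⟨x, y, ⟨hx, hy, hne⟩, h⟩
  rw [hhalf]
  refine Nat.mul_le_mul_left 2 (card_le_sum_hDim_of_expansion hd Y hY
    (∏ α ∈ innerSet Y, (Polynomial.X - Polynomial.C α)) (fun x hx y hy hne => ?_) ?_ s f hexp)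
  · rw [Polynomial.eval_prod]
    exact Finset.prod_eq_zero ((hmem _).mpr ⟨x, hx, y, hy, hne, rfl⟩) (by simp)
  · rw [Polynomial.eval_prod]
    refine Finset.prod_pos fun α hα => ?_
    obtain ⟨x, hx, y, hy, hne, rfl⟩ := (hmem α).mp hα
    have := (inner_lt_one_iff_real_of_norm_eq_one (hY x hx) (hY y hy)).mpr hne
    simpa using this
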